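/- arXiv:1712.05993 — 6 statements merged into one kernel-verified Lean document; each statement's English description precedes it below -/
import Mathlib

section
/- (Fiedler, eigenvector statement) Let W ∈ ℝ^{n×n} be symmetric with nonnegative entries and L = Lap(W). Assume the kernel of L is exactly two-dimensional (equivalently 0 = λ₂ < λ₃ for the sorted eigenvalues of L). Let x ∈ ℝⁿ be nonzero with Lx = 0 and ⟨x, 𝟙⟩ = 0. Then there exist real numbers a < 0 < b such that every entry of x equals a or b, and for all vertices i, j one has x_i = x_j if and only if i and j lie in the same connected component of the weighted graph of W; in particular the sets {i : x_i = a} and {i : x_i = b} are the two connected components. -/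
open Matrix BigOperators

/-- The graph Laplacian `Lap(W) = diag(W 𝟙) - W`. -/
noncomputable def Lap {n : ℕ} (W : Matrix (Fin n) (Fin n) ℝ) : Matrix (Fin n) (Fin n) ℝ :=
  Matrix.diagonal (W.mulVec fun _ => (1 : ℝ)) - W

/-- Vertices `i` and `j` are in the same connected component of the weighted graph of `W`
if they are joined by a path of edges with positive weight. -/
def SameComponent {n : ℕ} (W : Matrix (Fin n) (Fin n) ℝ) (i j : Fin n) : Prop :=
  Relation.ReflTransGen (fun p q => 0 < W p q) i j

theorem Lap_mulVec_apply {n : ℕ} (W : Matrix (Fin n) (Fin n) ℝ) (y : Fin n → ℝ) (i : Fin n) :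
    (Lap W).mulVec y i = ∑ j, W i j * (y i - y j) := by
  rw [Lap, Matrix.sub_mulVec, Pi.sub_apply, Matrix.mulVec_diagonal]
  simp [Matrix.mulVec, dotProduct, mul_sub, Finset.sum_sub_distrib, Finset.sum_mul]

theorem Lap_mulVec_eq_zero_iff {n : ℕ} {W : Matrix (Fin n) (Fin n) ℝ} (hsym : W.IsSymm)
    (hnonneg : ∀ i j, 0 ≤ W i j) (y : Fin n → ℝ) :
    (Lap W).mulVec y = 0 ↔ ∀ i j, 0 < W i j → y i = y j := by
  constructor
  · intro h
    have hrow : ∑ i, ∑ j, W i j * (y i - y j) * y i = 0 := by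
      refine Finset.sum_eq_zero fun i _ => ?_
      rw [← Finset.sum_mul, ← Lap_mulVec_apply, h, Pi.zero_apply, zero_mul]
    have hcol : ∑ i, ∑ j, W i j * (y j - y i) * y j = 0 := by
      rw [Finset.sum_comm, ← hrow]
      exact Finset.sum_congr rfl fun i _ => Finset.sum_congr rfl fun j _ => by
        rw [hsym.apply i j]
    have hsq : ∑ i, ∑ j, W i j * (y i - y j) ^ 2 = 0 := by
      rw [← add_zero (0 : ℝ)]
      nth_rewrite 1 [← hrow]
      rw [← hcol, ← Finset.sum_add_distrib]
      refine Finset.sum_congr rfl fun i _ => ?_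
      rw [← Finset.sum_add_distrib]
      exact Finset.sum_congr rfl fun j _ => by ring
    have hterm : ∀ i j, 0 ≤ W i j * (y i - y j) ^ 2 := fun i j =>
      mul_nonneg (hnonneg i j) (sq_nonneg _)
    intro i j hij
    have hi := (Finset.sum_eq_zero_iff_of_nonneg
      fun i _ => Finset.sum_nonneg fun j _ => hterm i j).1 hsq i (Finset.mem_univ i)
    have hj := (Finset.sum_eq_zero_iff_of_nonneg fun j _ => hterm i j).1 hi j (Finset.mem_univ j)
    rcases mul_eq_zero.1 hj with h0 | h0
    · exact absurd h0 hij.ne'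
    · exact sub_eq_zero.1 (pow_eq_zero_iff two_ne_zero |>.1 h0)
  · intro h
    ext i
    rw [Lap_mulVec_apply]
    refine Finset.sum_eq_zero fun j _ => ?_
    rcases (hnonneg i j).eq_or_lt with h0 | h0
    · rw [← h0, zero_mul]
    · rw [h i j h0, sub_self, mul_zero]

theorem exists_affine_of_finrank_eq_two {ι : Type*} [Finite ι] {K : Submodule ℝ (ι → ℝ)}
    (hK : Module.finrank ℝ K = 2) (hone : (fun _ => 1) ∈ K) {x : ι → ℝ} (hx : x ∈ K)
    {p q : ι} (hpq : x p ≠ x q) {y : ι → ℝ} (hy : y ∈ K) :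
    ∃ c d : ℝ, ∀ i, y i = c + d * x i := by
  have hli : LinearIndependent ℝ ![(fun _ => 1 : ι → ℝ), x] := by
    rw [LinearIndependent.pair_iff]
    intro s t hst
    have hp := congrFun hst p
    have hq := congrFun hst q
    simp only [Pi.add_apply, Pi.smul_apply, smul_eq_mul, mul_one, Pi.zero_apply] at hp hq
    have ht : t = 0 := by
      have : t * (x p - x q) = 0 := by linarith
      exact (mul_eq_zero.1 this).resolve_right (sub_ne_zero.2 hpq)
    subst ht
    exact ⟨by linarith, rfl⟩
  have hspan : Submodule.span ℝ (Set.range ![(fun _ => 1 : ι → ℝ), x]) = K := by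
    refine Submodule.eq_of_le_of_finrank_eq (Submodule.span_le.2 ?_) ?_
    · rintro _ ⟨k, rfl⟩
      fin_cases k
      · exact hone
      · exact hx
    · rw [finrank_span_eq_card hli, hK, Fintype.card_fin]
  rw [← hspan, Matrix.range_cons_cons_empty, Submodule.mem_span_pair] at hy
  obtain ⟨c, d, rfl⟩ := hy
  exact ⟨c, d, fun i => by simp⟩

/-- **Fiedler, eigenvector statement.** Let `W` be symmetric with nonnegative
entries, `L = Lap W`, and assume the kernel of `L` is exactly two-dimensional. If `x ≠ 0`
satisfies `L x = 0` and `⟨x, 𝟙⟩ = 0`, then there are `a < 0 < b` such that every entry of `x`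
equals `a` or `b`, and `x i = x j` iff `i` and `j` lie in the same connected component of the
weighted graph of `W`; in particular `{i : x i = a}` and `{i : x i = b}` are the two connected
components. -/
theorem fiedler_eigenvector_two_values {n : ℕ}
    (W : Matrix (Fin n) (Fin n) ℝ) (hsym : W.IsSymm) (hnonneg : ∀ i j, 0 ≤ W i j)
    (hker : Module.finrank ℝ (LinearMap.ker (Lap W).mulVecLin) = 2)
    (x : Fin n → ℝ) (hx : x ≠ 0) (hLx : (Lap W).mulVec x = 0)
    (horth : ∑ i, x i = 0) :
    ∃ a b : ℝ, a < 0 ∧ 0 < b ∧ (∀ i, x i = a ∨ x i = b) ∧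
      ∀ i j, x i = x j ↔ SameComponent W i j := by
  have hmem : ∀ y : Fin n → ℝ, y ∈ LinearMap.ker (Lap W).mulVecLin ↔
      ∀ i j, 0 < W i j → y i = y j := fun y => by
    rw [LinearMap.mem_ker, Matrix.mulVecLin_apply, Lap_mulVec_eq_zero_iff hsym hnonneg]
  have hedge := (Lap_mulVec_eq_zero_iff hsym hnonneg x).1 hLx
  have hxne : ∃ i ∈ Finset.univ, x i ≠ 0 := by
    obtain ⟨i, hi⟩ := Function.ne_iff.1 hx
    exact ⟨i, Finset.mem_univ i, hi⟩
  obtain ⟨q, -, hq⟩ := Finset.exists_pos_of_sum_zero_of_exists_nonzero x horth hxne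
  obtain ⟨p, -, hp⟩ : ∃ i ∈ Finset.univ, x i < 0 := by
    obtain ⟨i, hi, h⟩ := Finset.exists_pos_of_sum_zero_of_exists_nonzero (fun i => -x i)
      (by simpa using horth) (by simpa using hxne)
    exact ⟨i, hi, neg_pos.1 h⟩
  have haff : ∀ y : Fin n → ℝ, (∀ i j, 0 < W i j → y i = y j) →
      ∃ c d : ℝ, ∀ i, y i = c + d * x i := fun y hy =>
    exists_affine_of_finrank_eq_two hker ((hmem _).2 fun _ _ _ => rfl) ((hmem x).2 hedge)
      (hp.trans hq).ne ((hmem y).2 hy)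
  refine ⟨x p, x q, hp, hq, fun r => ?_, fun i j => ⟨fun hij => ?_, fun hij => ?_⟩⟩
  · by_contra! hr
    obtain ⟨c, d, hcd⟩ := haff (fun i => (x i - x p) * (x i - x q)) fun i j h => by
      rw [hedge i j h]
    have h1 := hcd p
    have h2 := hcd q
    have h3 := hcd r
    simp only [sub_self, zero_mul, mul_zero] at h1 h2 h3
    have hd : d = 0 := by
      have : d * (x p - x q) = 0 := by linarith
      exact (mul_eq_zero.1 this).resolve_right (sub_ne_zero.2 (hp.trans hq).ne)
    subst hd
    have hc : c = 0 := by linarith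
    refine mul_ne_zero (sub_ne_zero.2 hr.1) (sub_ne_zero.2 hr.2) ?_
    rw [h3, hc, zero_mul, add_zero]
  · classical
    obtain ⟨c, d, hcd⟩ := haff (fun k => if SameComponent W i k then 1 else 0) fun k l h => by
      have hkl : SameComponent W i k ↔ SameComponent W i l :=
        ⟨fun hk => hk.tail h, fun hl => hl.tail (by rwa [hsym.apply k l])⟩
      simp only [hkl]
    have hi := hcd i
    have hj := hcd j
    rw [← hij, ← hi, if_pos (show SameComponent W i i from Relation.ReflTransGen.refl)] at hj
    by_contra hn
    rw [if_neg hn] at hj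
    exact zero_ne_one hj
  · induction hij with
    | refl => rfl
    | tail _ h ih => exact ih.trans (hedge _ _ h)
end

section
/- Let C(t) be a symmetric n×n real matrix-valued function of t, differentiable in a neighborhood of 0. Let λ₀ be a simple eigenvalue of C₀ = C(0) with associated eigenvector x₀ satisfying ‖x₀‖₂ = 1, and let λ(t) be a function defined near 0, continuous at 0, such that λ(t) is an eigenvalue of C(t) for each t and λ(t) → λ₀ as t → 0. Then λ(t) is differentiable at t = 0 with derivative λ̇(0) = x₀ᵀ Ċ(0) x₀. -/
open Matrix BigOperators Filter

/-- If `μ` is a simple eigenvalue of the symmetric matrix `A` with eigenvector `x`, `x ⬝ᵥ x = 1`,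
then the bordered matrix `A - μ • 1 + x xᵀ` is invertible. -/
theorem det_sub_smul_one_add_vecMulVec_ne_zero {ι : Type*} [Fintype ι] [DecidableEq ι]
    {A : Matrix ι ι ℝ} (hA : A.IsSymm) {μ : ℝ} {x : ι → ℝ}
    (hsimple : Module.finrank ℝ (LinearMap.ker (A - μ • 1).mulVecLin) = 1)
    (hx : A *ᵥ x = μ • x) (hxx : x ⬝ᵥ x = 1) :
    (A - μ • 1 + vecMulVec x x).det ≠ 0 := by
  intro hdet
  obtain ⟨v, hv0, hv⟩ := exists_mulVec_eq_zero_iff.mpr hdet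
  have hmul : A *ᵥ v - μ • v + (x ⬝ᵥ v) • x = 0 := by
    simpa [add_mulVec, sub_mulVec, smul_mulVec, vecMulVec_mulVec] using hv
  have hxA : x ⬝ᵥ A *ᵥ v = μ * (x ⬝ᵥ v) := by
    rw [dotProduct_mulVec, ← mulVec_transpose, hA.eq, hx, smul_dotProduct, smul_eq_mul]
  have hxv : x ⬝ᵥ v = 0 := by
    have h := congrArg (x ⬝ᵥ ·) hmul
    simpa [dotProduct_add, dotProduct_sub, dotProduct_smul, hxA, hxx] using h
  have hmem : ∀ u : ι → ℝ, A *ᵥ u = μ • u →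
      u ∈ LinearMap.ker (A - μ • 1).mulVecLin := fun u hu => by
    simp [hu]
  have hvA : A *ᵥ v = μ • v := by
    simpa [hxv, sub_eq_zero] using hmul
  have hx0 : (⟨x, hmem x hx⟩ : LinearMap.ker (A - μ • 1).mulVecLin) ≠ 0 := by
    intro h
    have : x = 0 := congrArg Subtype.val h
    simp [this] at hxx
  obtain ⟨c, hc⟩ := (finrank_eq_one_iff_of_nonzero' _ hx0).mp hsimple ⟨v, hmem v hvA⟩
  have hcv : c • x = v := congrArg Subtype.val hc
  have hc0 : c = 0 := by
    simpa [← hcv, dotProduct_smul, hxx] using hxv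
  exact hv0 (by simp [← hcv, hc0])

/-- An eigenvalue `ν` of `M` near a simple eigenvalue `μ` of `A` is determined by the solution of
the bordered linear system. -/
theorem sub_eq_dotProduct_mulVec_bordered_inv {ι : Type*} [Fintype ι] [DecidableEq ι]
    {A M : Matrix ι ι ℝ} (hA : A.IsSymm) {μ ν : ℝ} {x v : ι → ℝ}
    (hx : A *ᵥ x = μ • x) (hv0 : v ≠ 0) (hv : M *ᵥ v = ν • v)
    (hdet : (M - ν • 1 + vecMulVec x x).det ≠ 0) :
    ν - μ = x ⬝ᵥ (M - A) *ᵥ ((M - ν • 1 + vecMulVec x x)⁻¹ *ᵥ x) := by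
  set B := M - ν • 1 + vecMulVec x x with hB
  have hBv : B *ᵥ v = (x ⬝ᵥ v) • x := by
    simp [hB, add_mulVec, sub_mulVec, smul_mulVec, vecMulVec_mulVec, hv]
  have hvw : v = (x ⬝ᵥ v) • (B⁻¹ *ᵥ x) := by
    rw [← mulVec_smul, ← hBv, mulVec_mulVec, nonsing_inv_mul _ hdet.isUnit, one_mulVec]
  have hc : x ⬝ᵥ v ≠ 0 := fun h => hv0 (by rw [hvw, h, zero_smul])
  have hxA : x ⬝ᵥ A *ᵥ v = μ * (x ⬝ᵥ v) := by
    rw [dotProduct_mulVec, ← mulVec_transpose, hA.eq, hx, smul_dotProduct, smul_eq_mul]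
  have h : x ⬝ᵥ (M - A) *ᵥ v = (ν - μ) * (x ⬝ᵥ v) := by
    rw [sub_mulVec, dotProduct_sub, hv, hxA, dotProduct_smul, smul_eq_mul, sub_mul]
  apply mul_right_cancel₀ hc
  rw [← h]
  conv_lhs => rw [hvw, mulVec_smul, dotProduct_smul, smul_eq_mul, mul_comm]

/-- **derivative of a simple eigenvalue.** Let `C(t)` be a symmetric,
entrywise differentiable (in a neighborhood of `0`) matrix-valued function, let `λ₀` be a
simple eigenvalue of `C(0)` with unit eigenvector `x₀`, and let `λ(t)` be an eigenvalue of
`C(t)` for all `t` near `0` with `λ(t) → λ₀` as `t → 0`. Then `λ` is differentiable at `0`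
with `λ̇(0) = x₀ᵀ Ċ(0) x₀`. -/
theorem simple_eigenvalue_derivative {n : ℕ}
    (C : ℝ → Matrix (Fin n) (Fin n) ℝ) (C' : Matrix (Fin n) (Fin n) ℝ)
    (hCsym : ∀ t, (C t).IsSymm)
    (hdiff : ∀ᶠ t in nhds (0 : ℝ), ∀ i j, DifferentiableAt ℝ (fun s => C s i j) t)
    (hderiv : ∀ i j, HasDerivAt (fun s => C s i j) (C' i j) 0)
    (lam0 : ℝ) (x0 : Fin n → ℝ)
    (hsimple : Module.finrank ℝ (LinearMap.ker (C 0 - lam0 • 1).mulVecLin) = 1)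
    (hx0 : (C 0).mulVec x0 = lam0 • x0)
    (hx0norm : Real.sqrt (∑ i, x0 i ^ 2) = 1)
    (lam : ℝ → ℝ)
    (heig : ∀ᶠ t in nhds (0 : ℝ), ∃ v : Fin n → ℝ, v ≠ 0 ∧ (C t).mulVec v = lam t • v)
    (hlim : Tendsto lam (nhds 0) (nhds lam0)) :
    HasDerivAt lam (x0 ⬝ᵥ C'.mulVec x0) 0 := by
  have hxx : x0 ⬝ᵥ x0 = 1 := by
    simpa [dotProduct, sq] using Real.sqrt_eq_one.mp hx0norm
  have hlam0 : lam 0 = lam0 :=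
    tendsto_nhds_unique (tendsto_pure_nhds lam 0) (hlim.mono_left (pure_le_nhds 0))
  have hC : Tendsto C (nhds 0) (nhds (C 0)) :=
    tendsto_pi_nhds.mpr fun i => tendsto_pi_nhds.mpr fun j => (hderiv i j).continuousAt
  have hslope : Tendsto (fun t => t⁻¹ • (C t - C 0)) (nhdsWithin 0 {0}ᶜ) (nhds C') :=
    tendsto_pi_nhds.mpr fun i => tendsto_pi_nhds.mpr fun j => by
      simpa using (hderiv i j).tendsto_slope_zero
  set B : ℝ → Matrix (Fin n) (Fin n) ℝ := fun t => C t - lam t • 1 + vecMulVec x0 x0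
  have hdet0 : (C 0 - lam0 • 1 + vecMulVec x0 x0).det ≠ 0 :=
    det_sub_smul_one_add_vecMulVec_ne_zero (hCsym 0) hsimple hx0 hxx
  have hB : Tendsto B (nhds 0) (nhds (C 0 - lam0 • 1 + vecMulVec x0 x0)) :=
    (hC.sub (hlim.smul_const 1)).add_const _
  have hdet : ∀ᶠ t in nhds 0, (B t).det ≠ 0 :=
    ((continuous_id.matrix_det.tendsto _).comp hB).eventually_ne hdet0
  have hw0 : (C 0 - lam0 • 1 + vecMulVec x0 x0)⁻¹ *ᵥ x0 = x0 := by
    have h : (C 0 - lam0 • 1 + vecMulVec x0 x0) *ᵥ x0 = x0 := by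
      simp [add_mulVec, sub_mulVec, smul_mulVec, vecMulVec_mulVec, hx0, hxx]
    have h' := congrArg ((C 0 - lam0 • 1 + vecMulVec x0 x0)⁻¹ *ᵥ ·) h
    simp only [mulVec_mulVec, nonsing_inv_mul _ hdet0.isUnit, one_mulVec] at h'
    exact h'.symm
  have hw : Tendsto (fun t => (B t)⁻¹ *ᵥ x0) (nhds 0) (nhds x0) := by
    have hinv : Tendsto (fun t => (B t)⁻¹) (nhds 0)
        (nhds (C 0 - lam0 • 1 + vecMulVec x0 x0)⁻¹) := by
      simp only [inv_def, Ring.inverse_eq_inv']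
      exact (((continuous_id.matrix_det.tendsto _).comp hB).inv₀ hdet0).smul
        ((continuous_id.matrix_adjugate.tendsto _).comp hB)
    have hmul : Continuous fun M : Matrix (Fin n) (Fin n) ℝ => M *ᵥ x0 :=
      continuous_id.matrix_mulVec continuous_const
    simpa [hw0, Function.comp_def] using (hmul.tendsto _).comp hinv
  rw [hasDerivAt_iff_tendsto_slope_zero]
  have hcont : Continuous fun p : Matrix (Fin n) (Fin n) ℝ × (Fin n → ℝ) =>
      x0 ⬝ᵥ p.1 *ᵥ p.2 :=
    continuous_const.dotProduct (continuous_fst.matrix_mulVec continuous_snd)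
  refine ((hcont.tendsto (C', x0)).comp
    (hslope.prodMk_nhds (hw.mono_left nhdsWithin_le_nhds))).congr' ?_
  filter_upwards [nhdsWithin_le_nhds heig, nhdsWithin_le_nhds hdet] with t ⟨v, hv0, hv⟩ hdt
  have h := sub_eq_dotProduct_mulVec_bordered_inv (hCsym 0) hx0 hv0 hv hdt
  simp [zero_add, hlam0, h, smul_mulVec, dotProduct_smul, B]
end

section
/- Let P be the entrywise projection onto a set of index pairs and let I ⊆ (0,∞) be an open interval. Let E : I → ℝ^{n×n} be differentiable with ‖E(ε)‖_F = 1 for all ε ∈ I, and suppose there is a fixed matrix R ∈ ℝ^{n×n} with (Id − P)(ε E(ε)) = R for all ε ∈ I. Then for all ε ∈ I, ⟨P E(ε), P E′(ε)⟩ = ‖R‖²/ε³. -/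
open Matrix BigOperators

/-- The Frobenius inner product `⟨X, Y⟩ = trace(Xᵀ Y)`. -/
noncomputable def finner {n : ℕ} (X Y : Matrix (Fin n) (Fin n) ℝ) : ℝ :=
  (Xᵀ * Y).trace

/-- The Frobenius norm. -/
noncomputable def frobNorm {n : ℕ} (A : Matrix (Fin n) (Fin n) ℝ) : ℝ :=
  Real.sqrt (finner A A)

/-- The entrywise projection onto the sparsity pattern `S`. -/
noncomputable def proj {n : ℕ} (S : Set (Fin n × Fin n)) (A : Matrix (Fin n) (Fin n) ℝ) :
    Matrix (Fin n) (Fin n) ℝ :=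
  Matrix.of fun i j => S.indicator (fun p => A p.1 p.2) (i, j)

theorem finner_eq_sum {n : ℕ} (X Y : Matrix (Fin n) (Fin n) ℝ) :
    finner X Y = ∑ j, ∑ i, X i j * Y i j := by
  simp [finner, Matrix.trace, Matrix.mul_apply]

theorem frobNorm_sq {n : ℕ} (A : Matrix (Fin n) (Fin n) ℝ) : frobNorm A ^ 2 = finner A A := by
  rw [frobNorm, Real.sq_sqrt]
  rw [finner_eq_sum]
  exact Finset.sum_nonneg fun j _ => Finset.sum_nonneg fun i _ => mul_self_nonneg _

/-- A differentiable curve of constant Frobenius norm is orthogonal to its derivative. -/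
theorem finner_deriv_eq_zero {n : ℕ} {E : ℝ → Matrix (Fin n) (Fin n) ℝ}
    {D : Matrix (Fin n) (Fin n) ℝ} {x c : ℝ}
    (hE : ∀ i j, HasDerivAt (fun s => E s i j) (D i j) x)
    (hc : ∀ᶠ s in nhds x, frobNorm (E s) = c) : finner (E x) D = 0 := by
  have h₁ : HasDerivAt (fun s => ∑ j, ∑ i, E s i j * E s i j)
      (∑ j, ∑ i, (D i j * E x i j + E x i j * D i j)) x :=
    HasDerivAt.fun_sum fun j _ => HasDerivAt.fun_sum fun i _ => (hE i j).mul (hE i j)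
  have h₂ : HasDerivAt (fun s => ∑ j, ∑ i, E s i j * E s i j) 0 x := by
    refine (hasDerivAt_const x (c ^ 2)).congr_of_eventuallyEq ?_
    filter_upwards [hc] with s hs
    rw [← hs, frobNorm_sq, finner_eq_sum]
  have h₃ := h₁.unique h₂
  have h₄ : ∑ j, ∑ i, (D i j * E x i j + E x i j * D i j) = 2 * finner (E x) D := by
    simp only [finner_eq_sum, Finset.mul_sum]
    exact Finset.sum_congr rfl fun j _ => Finset.sum_congr rfl fun i _ => by ring
  linarith

/-- If `s * f s` is locally constant near `x ≠ 0`, then `f x * f' x` is determined by its value. -/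
theorem mul_deriv_of_eventually_mul_eq {f : ℝ → ℝ} {d x r : ℝ} (hx : x ≠ 0)
    (hf : HasDerivAt f d x) (hr : ∀ᶠ s in nhds x, s * f s = r) :
    f x * d = -(r * r / x ^ 3) := by
  have h₁ := (hasDerivAt_id x).mul hf
  have h₂ : HasDerivAt (id * f) 0 x :=
    (hasDerivAt_const x r).congr_of_eventuallyEq hr
  have h₃ : f x + x * d = 0 := by simpa using h₁.unique h₂
  rw [← hr.self_of_nhds]
  field_simp
  linear_combination f x * h₃

/-- Let `E : I → ℝ^{n×n}` be differentiable on an open interval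
`I ⊆ (0, ∞)` with `‖E(ε)‖_F = 1` for all `ε ∈ I`, and suppose `(Id - P)(ε E(ε)) = R` is
constant on `I`. Then `⟨P E(ε), P E'(ε)⟩ = ‖R‖²/ε³` for all `ε ∈ I`. -/
theorem projected_derivative_inner_product {n : ℕ}
    (S : Set (Fin n × Fin n)) (I : Set ℝ) (hIopen : IsOpen I)
    (hIpos : I ⊆ Set.Ioi (0 : ℝ)) (hIinterval : I.OrdConnected)
    (E E' : ℝ → Matrix (Fin n) (Fin n) ℝ)
    (hE' : ∀ ε ∈ I, ∀ i j, HasDerivAt (fun s => E s i j) (E' ε i j) ε)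
    (hnorm : ∀ ε ∈ I, frobNorm (E ε) = 1)
    (R : Matrix (Fin n) (Fin n) ℝ)
    (hR : ∀ ε ∈ I, ε • E ε - proj S (ε • E ε) = R) :
    ∀ ε ∈ I, finner (proj S (E ε)) (proj S (E' ε)) = frobNorm R ^ 2 / ε ^ 3 := by
  intro ε hε
  have hmem : ∀ᶠ s in nhds ε, s ∈ I := hIopen.mem_nhds hε
  have hε0 : ε ≠ 0 := (hIpos hε).ne'
  have horth : finner (E ε) (E' ε) = 0 :=
    finner_deriv_eq_zero (hE' ε hε) (hmem.mono hnorm)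
  have hentry : ∀ i j, proj S (E ε) i j * proj S (E' ε) i j =
      E ε i j * E' ε i j + R i j * R i j / ε ^ 3 := by
    intro i j
    by_cases hij : (i, j) ∈ S
    · have hRij : R i j = 0 := by
        rw [← hR ε hε]
        simp [proj, hij]
      simp [proj, hij, hRij]
    · have hRij : ∀ᶠ s in nhds ε, s * E s i j = R i j := by
        filter_upwards [hmem] with s hs
        rw [← hR s hs]
        simp [proj, hij]
      rw [mul_deriv_of_eventually_mul_eq hε0 (hE' ε hε i j) hRij]
      simp [proj, hij]
  rw [finner_eq_sum] at horth
  rw [frobNorm_sq, finner_eq_sum, finner_eq_sum]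
  simp only [hentry, Finset.sum_add_distrib, horth, zero_add, Finset.sum_div]
end

section
/- (Equivalence of the Frobenius-norm minimum cut and the nearness problem) Let W = (w_ij) ∈ ℝ^{n×n} be symmetric with nonnegative entries, n ≥ 2, and let ℰ = {(i,j) : w_ij > 0}. Then the minimum of Σ_{i,j=1}^n (ŵ_ij − w_ij)² over all symmetric matrices Ŵ = (ŵ_ij) with nonnegative entries, with ŵ_ij = 0 whenever (i,j) ∉ ℰ, and whose weighted graph is disconnected, equals the minimum over all nonempty proper subsets S ⊂ {1,…,n} of Σ_{i ∈ S, j ∉ S} 2 w_ij², and this minimum is attained by the matrix Ŵ obtained from W by setting w_ij = 0 for all pairs with i ∈ S, j ∉ S (for a minimizing S) and leaving all other entries unchanged. -/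
open Matrix BigOperators

/-- The weighted graph of a symmetric nonnegative matrix is disconnected if there is a
nonempty proper vertex subset with no edges to its complement. -/
def IsDisconnected {n : ℕ} (A : Matrix (Fin n) (Fin n) ℝ) : Prop :=
  ∃ T : Finset (Fin n), T.Nonempty ∧ T ≠ Finset.univ ∧ ∀ i ∈ T, ∀ j ∉ T, A i j = 0

/-- Squared Frobenius distance `∑ᵢⱼ (ŵᵢⱼ - wᵢⱼ)²`. -/
noncomputable def distSq {n : ℕ} (W What : Matrix (Fin n) (Fin n) ℝ) : ℝ :=
  ∑ i, ∑ j, (What i j - W i j) ^ 2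

/-- The cut value `∑_{i ∈ S, j ∉ S} 2 wᵢⱼ²` of a vertex subset `S`. -/
noncomputable def cutVal {n : ℕ} (W : Matrix (Fin n) (Fin n) ℝ) (S : Finset (Fin n)) : ℝ :=
  ∑ i ∈ S, ∑ j ∈ Sᶜ, 2 * W i j ^ 2

/-- The matrix obtained from `W` by setting to zero all entries across the cut given by `S`. -/
noncomputable def cutMatrix {n : ℕ} (W : Matrix (Fin n) (Fin n) ℝ) (S : Finset (Fin n)) :
    Matrix (Fin n) (Fin n) ℝ :=
  Matrix.of fun i j => if (i ∈ S ∧ j ∉ S) ∨ (j ∈ S ∧ i ∉ S) then 0 else W i j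

/-- For symmetric `W`, the cut value is the sum of the squares of all entries across the cut. -/
lemma cutVal_eq_sum_ite {n : ℕ} {W : Matrix (Fin n) (Fin n) ℝ} (hsym : W.IsSymm)
    (S : Finset (Fin n)) :
    cutVal W S =
      ∑ i, ∑ j, if (i ∈ S ∧ j ∉ S) ∨ (j ∈ S ∧ i ∉ S) then W i j ^ 2 else 0 := by
  have hcut : cutVal W S = 2 * ∑ i, ∑ j, if i ∈ S ∧ j ∉ S then W i j ^ 2 else 0 := by
    simp only [cutVal, ← Finset.mul_sum, ite_and, Finset.sum_ite_irrel, Finset.sum_const_zero]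
    rw [Finset.sum_ite_mem, Finset.univ_inter]
    refine congrArg (2 * ·) (Finset.sum_congr rfl fun i _ => ?_)
    simp only [← Finset.mem_compl, Finset.sum_ite_mem, Finset.univ_inter]
  have hswap : ∑ i, ∑ j, (if j ∈ S ∧ i ∉ S then W i j ^ 2 else 0) =
      ∑ i, ∑ j, if i ∈ S ∧ j ∉ S then W i j ^ 2 else 0 := by
    rw [Finset.sum_comm]
    simp only [hsym.apply]
  rw [hcut, two_mul]
  nth_rewrite 2 [← hswap]
  simp only [← Finset.sum_add_distrib]
  refine Finset.sum_congr rfl fun i _ => Finset.sum_congr rfl fun j _ => ?_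
  by_cases hi : i ∈ S <;> by_cases hj : j ∈ S <;> simp [hi, hj]

lemma distSq_cutMatrix {n : ℕ} {W : Matrix (Fin n) (Fin n) ℝ} (hsym : W.IsSymm)
    (S : Finset (Fin n)) : distSq W (cutMatrix W S) = cutVal W S := by
  rw [cutVal_eq_sum_ite hsym, distSq]
  refine Finset.sum_congr rfl fun i _ => Finset.sum_congr rfl fun j _ => ?_
  rw [cutMatrix, Matrix.of_apply]
  split_ifs <;> simp

/-- A symmetric matrix vanishing across the cut `T` is at squared distance at least
`cutVal W T` from `W`. -/
lemma cutVal_le_distSq {n : ℕ} {W What : Matrix (Fin n) (Fin n) ℝ} (hsym : W.IsSymm)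
    (hsym' : What.IsSymm) {T : Finset (Fin n)} (hT : ∀ i ∈ T, ∀ j ∉ T, What i j = 0) :
    cutVal W T ≤ distSq W What := by
  rw [cutVal_eq_sum_ite hsym, distSq]
  refine Finset.sum_le_sum fun i _ => Finset.sum_le_sum fun j _ => ?_
  split_ifs with h
  · have h0 : What i j = 0 := by
      rcases h with ⟨hi, hj⟩ | ⟨hj, hi⟩
      · exact hT i hi j hj
      · rw [← hsym'.apply]
        exact hT j hj i hi
    simp [h0]
  · positivity

lemma cutMatrix_isSymm {n : ℕ} {W : Matrix (Fin n) (Fin n) ℝ} (hsym : W.IsSymm)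
    (S : Finset (Fin n)) : (cutMatrix W S).IsSymm := by
  refine Matrix.IsSymm.ext fun i j => ?_
  simp only [cutMatrix, Matrix.of_apply, hsym.apply i j, or_comm]

lemma cutMatrix_nonneg {n : ℕ} {W : Matrix (Fin n) (Fin n) ℝ} (hnonneg : ∀ i j, 0 ≤ W i j)
    (S : Finset (Fin n)) (i j : Fin n) : 0 ≤ cutMatrix W S i j := by
  rw [cutMatrix, Matrix.of_apply]
  split_ifs
  exacts [le_rfl, hnonneg i j]

lemma cutMatrix_eq_zero_of_eq_zero {n : ℕ} {W : Matrix (Fin n) (Fin n) ℝ} (S : Finset (Fin n))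
    {i j : Fin n} (h : W i j = 0) : cutMatrix W S i j = 0 := by
  rw [cutMatrix, Matrix.of_apply, h, ite_self]

lemma isDisconnected_cutMatrix {n : ℕ} (W : Matrix (Fin n) (Fin n) ℝ) {S : Finset (Fin n)}
    (hS : S.Nonempty) (hS' : S ≠ Finset.univ) : IsDisconnected (cutMatrix W S) :=
  ⟨S, hS, hS', fun i hi j hj => by simp [cutMatrix, hi, hj]⟩

lemma exists_min_cutVal {n : ℕ} (hn : 2 ≤ n) (W : Matrix (Fin n) (Fin n) ℝ) :
    ∃ S : Finset (Fin n), (S.Nonempty ∧ S ≠ Finset.univ) ∧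
      ∀ T : Finset (Fin n), T.Nonempty → T ≠ Finset.univ → cutVal W S ≤ cutVal W T := by
  have hne : {S : Finset (Fin n) | S.Nonempty ∧ S ≠ Finset.univ}.Nonempty := by
    refine ⟨{⟨0, by omega⟩}, Finset.singleton_nonempty _, fun h => ?_⟩
    have hcard := congrArg Finset.card h
    simp only [Finset.card_singleton, Finset.card_univ, Fintype.card_fin] at hcard
    omega
  obtain ⟨S, hS, hmin⟩ := Set.exists_min_image _ (cutVal W) (Set.toFinite _) hne
  exact ⟨S, hS, fun T hT hT' => hmin T ⟨hT, hT'⟩⟩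

/-- **equivalence of the Frobenius-norm minimum cut and the nearness problem.**
For symmetric nonnegative `W` with `n ≥ 2`, the minimum of `∑ᵢⱼ (ŵᵢⱼ - wᵢⱼ)²` over all
symmetric nonnegative matrices `Ŵ` with the sparsity pattern of `W` whose weighted graph is
disconnected equals the minimum over all nonempty proper `S ⊂ {1,…,n}` of
`∑_{i ∈ S, j ∉ S} 2 wᵢⱼ²`, and it is attained by the matrix obtained from `W` by zeroing out
the entries across a minimizing cut `S`. -/
theorem min_cut_equals_nearness {n : ℕ} (hn : 2 ≤ n)
    (W : Matrix (Fin n) (Fin n) ℝ) (hsym : W.IsSymm) (hnonneg : ∀ i j, 0 ≤ W i j) :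
    ∃ S : Finset (Fin n), S.Nonempty ∧ S ≠ Finset.univ ∧
      IsLeast {c : ℝ | ∃ T : Finset (Fin n), T.Nonempty ∧ T ≠ Finset.univ ∧ c = cutVal W T}
        (cutVal W S) ∧
      IsLeast {d : ℝ | ∃ What : Matrix (Fin n) (Fin n) ℝ, What.IsSymm ∧
          (∀ i j, 0 ≤ What i j) ∧ (∀ i j, ¬ 0 < W i j → What i j = 0) ∧
          IsDisconnected What ∧ d = distSq W What}
        (cutVal W S) ∧
      (cutMatrix W S).IsSymm ∧ (∀ i j, 0 ≤ cutMatrix W S i j) ∧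
      (∀ i j, ¬ 0 < W i j → cutMatrix W S i j = 0) ∧
      IsDisconnected (cutMatrix W S) ∧
      distSq W (cutMatrix W S) = cutVal W S := by
  obtain ⟨S, ⟨hS, hS'⟩, hmin⟩ := exists_min_cutVal hn W
  have hzero (i j : Fin n) (h : ¬ 0 < W i j) : cutMatrix W S i j = 0 :=
    cutMatrix_eq_zero_of_eq_zero S (le_antisymm (not_lt.mp h) (hnonneg i j))
  have hsymm := cutMatrix_isSymm hsym S
  have hnn := cutMatrix_nonneg hnonneg S
  have hdisc := isDisconnected_cutMatrix W hS hS'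
  have hdist := distSq_cutMatrix hsym S
  refine ⟨S, hS, hS', ⟨⟨S, hS, hS', rfl⟩, ?_⟩,
    ⟨⟨cutMatrix W S, hsymm, hnn, hzero, hdisc, hdist.symm⟩, ?_⟩,
    hsymm, hnn, hzero, hdisc, hdist⟩
  · rintro _ ⟨T, hT, hT', rfl⟩
    exact hmin T hT hT'
  · rintro _ ⟨What, hW, -, -, ⟨T, hT, hT', hcut⟩, rfl⟩
    exact (hmin T hT hT').trans (cutVal_le_distSq hsym hW hcut)
end

section
/- (Derivative of the membership penalty) Let V⁻ ⊆ N ⊆ {1,…,n} with N nonempty, let x : ℝ → ℝⁿ be differentiable, and define m(t) = (1/|N|) Σ_{i ∈ N} x_i(t) and v(t) = −Σ_{i ∈ V⁻} (x_i(t) − m(t)) (e_i − 𝟙_N/|N|) ∈ ℝⁿ, where e_i is the i-th standard unit vector and 𝟙_N is the indicator vector of N. Then d/dt [ (1/2) Σ_{i ∈ V⁻} (x_i(t) − m(t))² ] = −⟨v(t), ẋ(t)⟩. -/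
open Matrix BigOperators

/-- **derivative of the membership penalty.** Let `V⁻ ⊆ N ⊆ {1,…,n}` with `N`
nonempty, `x : ℝ → ℝⁿ` differentiable, `m(t)` the average of `x(t)` over `N`, and
`v(t) = -∑_{i ∈ V⁻} (xᵢ(t) - m(t)) (eᵢ - 𝟙_N/|N|)`. Then
`d/dt [½ ∑_{i ∈ V⁻} (xᵢ(t) - m(t))²] = -⟨v(t), ẋ(t)⟩`. -/
theorem membership_penalty_derivative {n : ℕ}
    (N Vminus : Finset (Fin n)) (hVN : Vminus ⊆ N) (hN : N.Nonempty)
    (x x' : ℝ → Fin n → ℝ)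
    (hx : ∀ t i, HasDerivAt (fun s => x s i) (x' t i) t) (t : ℝ) :
    HasDerivAt
      (fun s => (1 / 2) * ∑ i ∈ Vminus,
        (x s i - (N.card : ℝ)⁻¹ * ∑ j ∈ N, x s j) ^ 2)
      (-((-∑ i ∈ Vminus,
          (x t i - (N.card : ℝ)⁻¹ * ∑ j ∈ N, x t j) •
            (Pi.single i (1 : ℝ) -
              (N.card : ℝ)⁻¹ • (fun j => if j ∈ N then (1 : ℝ) else 0))) ⬝ᵥ x' t))
      t := by
  have hmean : HasDerivAt (fun s => (N.card : ℝ)⁻¹ * ∑ j ∈ N, x s j)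
      ((N.card : ℝ)⁻¹ * ∑ j ∈ N, x' t j) t :=
    (HasDerivAt.fun_sum fun j _ => hx t j).const_mul _
  have hpenalty := (HasDerivAt.fun_sum (u := Vminus) fun i _ =>
    ((hx t i).sub hmean).fun_pow 2).const_mul (1 / 2 : ℝ)
  refine hpenalty.congr_deriv ?_
  have hind : (fun j => if j ∈ N then (1 : ℝ) else 0) ⬝ᵥ x' t = ∑ j ∈ N, x' t j := by
    simp [dotProduct]
  rw [neg_dotProduct, neg_neg, sum_dotProduct, Finset.mul_sum]
  refine Finset.sum_congr rfl fun i _ => ?_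
  rw [smul_dotProduct, sub_dotProduct, smul_dotProduct, single_one_dotProduct, hind]
  simp only [smul_eq_mul, Pi.sub_apply]
  push_cast
  ring
end

section
/- (Sufficiency of the tangency conditions) Let W = (w_ij) ∈ ℝ^{n×n} be symmetric with nonnegative entries, ℰ = {(i,j) : w_ij > 0}, and ε > 0. Let E ∈ ℝ^{n×n} be ε-feasible, i.e., ‖E‖_F = 1, E symmetric, P_ℰ(E) = E, and W + εE ≥ 0 entrywise. Let ℰ₀ = {(i,j) ∈ ℰ : w_ij + ε e_ij = 0}, and let Z ∈ ℝ^{n×n} satisfy ⟨E, Z⟩ = 0, Z symmetric, P_ℰ(Z) = Z, and z_ij ≥ 0 for all (i,j) ∈ ℰ₀. Then there exist δ > 0 and a map γ : [0, δ) → ℝ^{n×n} such that γ(0) = E, γ(t) is ε-feasible for every t ∈ [0, δ), and γ has right derivative Z at t = 0 (i.e., (γ(t) − E)/t → Z as t → 0⁺). -/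
open Matrix BigOperators Filter

/-- `E` is `ε`-feasible for `W` with sparsity pattern `ℰ`: unit Frobenius norm, symmetric,
sparsity pattern `ℰ`, and `W + ε E ≥ 0` entrywise. -/
def IsFeasible {n : ℕ} (W : Matrix (Fin n) (Fin n) ℝ) (Es : Set (Fin n × Fin n)) (ε : ℝ)
    (E : Matrix (Fin n) (Fin n) ℝ) : Prop :=
  frobNorm E = 1 ∧ E.IsSymm ∧ proj Es E = E ∧ ∀ i j, 0 ≤ W i j + ε * E i j

theorem finner_comm {n : ℕ} (X Y : Matrix (Fin n) (Fin n) ℝ) : finner X Y = finner Y X := by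
  unfold finner
  rw [← Matrix.trace_transpose, Matrix.transpose_mul, Matrix.transpose_transpose]

theorem finner_self_nonneg {n : ℕ} (X : Matrix (Fin n) (Fin n) ℝ) : 0 ≤ finner X X := by
  simp only [finner, Matrix.trace, Matrix.diag, Matrix.mul_apply, Matrix.transpose_apply]
  exact Finset.sum_nonneg fun _ _ => Finset.sum_nonneg fun _ _ => mul_self_nonneg _

theorem finner_smul_add_smul_self {n : ℕ} (E Z : Matrix (Fin n) (Fin n) ℝ) (c t : ℝ) :
    finner (c • (E + t • Z)) (c • (E + t • Z)) =
      c ^ 2 * (finner E E + 2 * t * finner E Z + t ^ 2 * finner Z Z) := by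
  have h := finner_comm Z E
  simp only [finner, Matrix.transpose_smul, Matrix.transpose_add, Matrix.smul_mul,
    Matrix.mul_smul, Matrix.add_mul, Matrix.mul_add, Matrix.trace_smul, Matrix.trace_add,
    smul_eq_mul] at h ⊢
  rw [h]
  ring

theorem proj_eq_self_iff {n : ℕ} (S : Set (Fin n × Fin n)) (A : Matrix (Fin n) (Fin n) ℝ) :
    proj S A = A ↔ ∀ i j, (i, j) ∉ S → A i j = 0 := by
  constructor
  · intro h i j hij
    rw [← h]
    simp [proj, hij]
  · intro h
    ext i j
    by_cases hij : (i, j) ∈ S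
    · simp [proj, hij]
    · simp [proj, hij, h i j hij]

theorem hasDerivAt_inv_sqrt_mul_add (a z q : ℝ) :
    HasDerivAt (fun t : ℝ => (√(1 + t ^ 2 * q))⁻¹ * (a + t * z)) z 0 := by
  have h1 : HasDerivAt (fun t : ℝ => 1 + t ^ 2 * q) 0 0 := by
    simpa using (((hasDerivAt_id (0 : ℝ)).pow 2).mul_const q).const_add 1
  have h2 : HasDerivAt (fun t : ℝ => (√(1 + t ^ 2 * q))⁻¹) 0 0 := by
    simpa using (h1.sqrt (by simp)).fun_inv (by simp)
  have h3 : HasDerivAt (fun t : ℝ => a + t * z) z 0 := by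
    simpa using ((hasDerivAt_id (0 : ℝ)).mul_const z).const_add a
  simpa using h2.fun_mul h3

/-- **sufficiency of the tangency conditions.** Let `W` be symmetric and
nonnegative with edge set `ℰ = {(i,j) : wᵢⱼ > 0}`, let `ε > 0`, let `E` be `ε`-feasible, let
`ℰ₀ = {(i,j) ∈ ℰ : wᵢⱼ + ε eᵢⱼ = 0}`, and let `Z` satisfy `⟨E, Z⟩ = 0`, be symmetric, have
sparsity pattern `ℰ`, and have `zᵢⱼ ≥ 0` for `(i,j) ∈ ℰ₀`. Then there are `δ > 0` and a path
`γ : [0, δ) → ℝ^{n×n}` of `ε`-feasible matrices with `γ(0) = E` whose right derivative at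
`t = 0` is `Z`. -/
theorem tangency_conditions_sufficient {n : ℕ}
    (W : Matrix (Fin n) (Fin n) ℝ) (hsym : W.IsSymm) (hnonneg : ∀ i j, 0 ≤ W i j)
    (ε : ℝ) (hε : 0 < ε)
    (E : Matrix (Fin n) (Fin n) ℝ)
    (hE : IsFeasible W {p : Fin n × Fin n | 0 < W p.1 p.2} ε E)
    (Z : Matrix (Fin n) (Fin n) ℝ)
    (hEZ : finner E Z = 0) (hZsym : Z.IsSymm)
    (hZsp : proj {p : Fin n × Fin n | 0 < W p.1 p.2} Z = Z)
    (hZpos : ∀ i j, 0 < W i j → W i j + ε * E i j = 0 → 0 ≤ Z i j) :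
    ∃ δ > (0 : ℝ), ∃ γ : ℝ → Matrix (Fin n) (Fin n) ℝ,
      γ 0 = E ∧
      (∀ t ∈ Set.Ico (0 : ℝ) δ, IsFeasible W {p : Fin n × Fin n | 0 < W p.1 p.2} ε (γ t)) ∧
      Tendsto (fun t => t⁻¹ • (γ t - E)) (nhdsWithin 0 (Set.Ioi 0)) (nhds Z) := by
  obtain ⟨hE1, hEsym, hEsp, hEpos⟩ := hE
  have hEE : finner E E = 1 := Real.sqrt_eq_one.mp hE1
  rw [proj_eq_self_iff] at hEsp hZsp
  have hev : ∀ᶠ t in nhdsWithin (0 : ℝ) (Set.Ici 0),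
      ∀ i j, 0 ≤ W i j + ε * (E i j + t * Z i j) := by
    refine eventually_all.2 fun i => eventually_all.2 fun j => ?_
    rcases (hEpos i j).lt_or_eq with h | h
    · have hc : ContinuousAt (fun t : ℝ => W i j + ε * (E i j + t * Z i j)) 0 := by fun_prop
      have h0 : 0 < W i j + ε * (E i j + 0 * Z i j) := by simpa using h
      exact ((hc.eventually_const_lt h0).mono fun t ht => ht.le).filter_mono nhdsWithin_le_nhds
    · have hz : 0 ≤ Z i j := by
        rcases (hnonneg i j).lt_or_eq with hw | hw
        · exact hZpos i j hw h.symm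
        · exact (hZsp i j (by simp [← hw])).ge
      filter_upwards [self_mem_nhdsWithin] with t ht
      have : 0 ≤ ε * (t * Z i j) := mul_nonneg hε.le (mul_nonneg ht hz)
      linarith
  obtain ⟨δ, hδ, hsub⟩ := mem_nhdsGE_iff_exists_Ico_subset.1 hev
  set q := finner Z Z
  have hq : 0 ≤ q := finner_self_nonneg Z
  refine ⟨δ, hδ, fun t => (√(1 + t ^ 2 * q))⁻¹ • (E + t • Z), by simp, ?_, ?_⟩
  · intro t ht
    have hs : 1 ≤ 1 + t ^ 2 * q := le_add_of_nonneg_right (by positivity)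
    have hc0 : 0 ≤ (√(1 + t ^ 2 * q))⁻¹ := by positivity
    have hc1 : (√(1 + t ^ 2 * q))⁻¹ ≤ 1 := inv_le_one_of_one_le₀ (Real.one_le_sqrt.2 hs)
    refine ⟨?_, (hEsym.add (hZsym.smul t)).smul _, ?_, fun i j => ?_⟩
    · rw [frobNorm, finner_smul_add_smul_self, hEE, hEZ, Real.sqrt_eq_one, inv_pow,
        Real.sq_sqrt (by linarith), mul_zero, add_zero]
      exact inv_mul_cancel₀ (by linarith)
    · rw [proj_eq_self_iff]
      intro i j hij
      simp [hEsp i j hij, hZsp i j hij]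
    · have h := add_nonneg (mul_nonneg hc0 (hsub ht i j))
        (mul_nonneg (sub_nonneg.2 hc1) (hnonneg i j))
      simp only [Matrix.smul_apply, Matrix.add_apply, smul_eq_mul]
      linarith
  · refine tendsto_pi_nhds.2 fun i => tendsto_pi_nhds.2 fun j => ?_
    have h := (hasDerivAt_inv_sqrt_mul_add (E i j) (Z i j) q).tendsto_slope_zero_right
    simpa [mul_add] using h
end
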